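/- arXiv:1607.03052 — 2 statements merged into one kernel-verified Lean document; each statement's English description precedes it below -/
import Mathlib

section
/- Let F = ∗_{α∈I} G_α be the free product of nontrivial groups G_α, let Ψ_o be a finite connected irreducible A-graph with base vertex o, and let H = H(Ψ_o) be the set of all elements φ(p) ∈ F, where p ranges over paths in Ψ_o with p₋ = p₊ = o. Then H is a factor-free subgroup of F and r̄(H) = −χ(Ψ_o), where χ(Ψ_o) = |VΨ_o| − |EΨ_o|/2 is the Euler characteristic of Ψ_o (edges counted as oriented edges). -/
open Monoid

section Defs

variable {F : Type} [Group F]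

def conjS (t : F) (K : Subgroup F) : Subgroup F := K.map (MulAut.conj t).toMonoidHom

noncomputable def rk (H : Subgroup F) : ℕ :=
  sInf {n : ℕ | ∃ S : Finset F, S.card = n ∧ Subgroup.closure (S : Set F) = H}

noncomputable def rrk (H : Subgroup F) : ℕ := rk H - 1

def dcSetoid (H K : Subgroup F) : Setoid F where
  r s t := ∃ h ∈ H, ∃ k ∈ K, h * s * k = t
  iseqv := by
    refine ⟨fun s => ⟨1, H.one_mem, 1, K.one_mem, by group⟩, ?_, ?_⟩
    · rintro s t ⟨h, hh, k, hk, rfl⟩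
      exact ⟨h⁻¹, H.inv_mem hh, k⁻¹, K.inv_mem hk, by group⟩
    · rintro s t u ⟨h, hh, k, hk, rfl⟩ ⟨h', hh', k', hk', rfl⟩
      exact ⟨h' * h, H.mul_mem hh' hh, k * k', K.mul_mem hk hk', by group⟩

noncomputable def rrkInter (H K : Subgroup F) : ℕ :=
  finsum fun q : Quotient (dcSetoid H K) => rrk (H ⊓ conjS q.out K)

def Noncyclic (H : Subgroup F) : Prop := ∀ g : F, H ≠ Subgroup.closure {g}

end Defs

section Graphs

/-- A labeled `A`-graph over the alphabet `A = ⊔_{i} G i`: a bipartite graph with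
primary and secondary vertices, oriented edges with a fixed-point-free involution
`bar`, a type function on (secondary) vertices and an edge labeling. -/
structure AGraph (ι : Type) (G : ι → Type) [∀ i, Group (G i)] : Type 1 where
  /-- vertices -/
  V : Type
  /-- oriented edges -/
  E : Type
  /-- `prim v` holds iff `v` is a primary vertex; otherwise `v` is secondary -/
  prim : V → Prop
  /-- the edge with the opposite orientation -/
  bar : E → E
  bar_bar : ∀ e, bar (bar e) = e
  bar_ne : ∀ e, bar e ≠ e
  /-- initial vertex -/
  ini : E → V
  /-- terminal vertex -/
  ter : E → V
  ini_bar : ∀ e, ini (bar e) = ter e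
  /-- every edge connects a primary and a secondary vertex -/
  bipartite : ∀ e, prim (ini e) ↔ ¬ prim (ter e)
  /-- the type of a (secondary) vertex -/
  typ : V → ι
  /-- the label of an edge, an element of `A = ⊔_i G i` -/
  lab : E → Σ i, G i
  lab_bar : ∀ e, lab (bar e) = ⟨(lab e).1, (lab e).2⁻¹⟩
  /-- the label of an edge ending in a secondary vertex of type `i` lies in `G i` -/
  lab_typ : ∀ e, ¬ prim (ter e) → (lab e).1 = typ (ter e)

namespace AGraph

variable {ι : Type} {G : ι → Type} [∀ i, Group (G i)] (Ψ : AGraph ι G)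

/-- The degree of a vertex: the number of oriented edges ending at it. -/
noncomputable def deg (v : Ψ.V) : ℕ := Set.ncard {e : Ψ.E | Ψ.ter e = v}

/-- `Ψ` is a finite graph. -/
def FiniteGraph : Prop := Finite Ψ.V ∧ Finite Ψ.E

/-- `Ψ` is a connected graph. -/
def Connected : Prop :=
  ∀ u v : Ψ.V,
    Relation.ReflTransGen (fun a b => ∃ e : Ψ.E, Ψ.ini e = a ∧ Ψ.ter e = b) u v

/-- Properties (P1)-(P3) of an irreducible `A`-graph. -/
def Irr : Prop :=
  (∀ e f : Ψ.E, Ψ.ini e = Ψ.ini f → Ψ.prim (Ψ.ini e) → Ψ.ter e ≠ Ψ.ter f →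
      Ψ.typ (Ψ.ter e) ≠ Ψ.typ (Ψ.ter f)) ∧
  (∀ e f : Ψ.E, e ≠ f → Ψ.ter e = Ψ.ter f → ¬ Ψ.prim (Ψ.ter e) → Ψ.lab e ≠ Ψ.lab f) ∧
  (∀ e f : Ψ.E, Ψ.ini e = Ψ.ini f → Ψ.ter e = Ψ.ter f → e = f) ∧
  (∀ v : Ψ.V, 0 < Ψ.deg v) ∧
  (∀ v w : Ψ.V, Ψ.deg v = 1 → Ψ.deg w = 1 → v = w) ∧
  (∀ v : Ψ.V, Ψ.deg v = 1 → Ψ.prim v)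

/-- A path in `Ψ`: a list of consecutive edges. -/
def IsPath (p : List Ψ.E) : Prop := p.Chain' fun e f => Ψ.ter e = Ψ.ini f

/-- A reduced path: a path with no subpath `e e⁻¹`. -/
def IsRedPath (p : List Ψ.E) : Prop :=
  p.Chain' fun e f => Ψ.ter e = Ψ.ini f ∧ f ≠ Ψ.bar e

/-- The path `p` is closed at `v` (a path of length `0` is closed at every vertex). -/
def ClosedAt (p : List Ψ.E) (v : Ψ.V) : Prop :=
  (∀ e ∈ p.head?, Ψ.ini e = v) ∧ (∀ e ∈ p.getLast?, Ψ.ter e = v)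

/-- The label of a path: the product of the labels of its edges, in `∗_i G i`. -/
def pathLabel (p : List Ψ.E) : CoprodI G :=
  (p.map fun e => CoprodI.of (Ψ.lab e).2).prod

/-- A cyclically reduced closed path: a nonempty reduced closed path whose cyclic
shift by one edge is also reduced. -/
def IsCycRed (p : List Ψ.E) : Prop :=
  p ≠ [] ∧ Ψ.IsRedPath p ∧
    ∀ e ∈ p.head?, ∀ f ∈ p.getLast?, Ψ.ter f = Ψ.ini e ∧ e ≠ Ψ.bar f

/-- The edges of the core of `Ψ`: the edges lying on a cyclically reduced closed path
(up to orientation). -/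
def coreES : Set Ψ.E := {e | ∃ p, Ψ.IsCycRed p ∧ (e ∈ p ∨ Ψ.bar e ∈ p)}

/-- The vertices of the core of `Ψ`. -/
def coreVS : Set Ψ.V := {v | ∃ e ∈ Ψ.coreES, Ψ.ini e = v ∨ Ψ.ter e = v}

/-- The core of `Ψ`: the minimal subgraph of `Ψ` containing every edge that lies on
a cyclically reduced closed path in `Ψ`. -/
def core : AGraph ι G where
  V := {v : Ψ.V // v ∈ Ψ.coreVS}
  E := {e : Ψ.E // e ∈ Ψ.coreES}
  prim v := Ψ.prim v.1
  bar e := ⟨Ψ.bar e.1, by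
    obtain ⟨p, hp, he⟩ := e.2
    refine ⟨p, hp, ?_⟩
    rcases he with h | h
    · exact Or.inr (by rwa [Ψ.bar_bar])
    · exact Or.inl h⟩
  bar_bar e := Subtype.ext (Ψ.bar_bar e.1)
  bar_ne e h := Ψ.bar_ne e.1 (congrArg Subtype.val h)
  ini e := ⟨Ψ.ini e.1, ⟨e.1, e.2, Or.inl rfl⟩⟩
  ter e := ⟨Ψ.ter e.1, ⟨e.1, e.2, Or.inr rfl⟩⟩
  ini_bar e := Subtype.ext (Ψ.ini_bar e.1)
  bipartite e := Ψ.bipartite e.1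
  typ v := Ψ.typ v.1
  lab e := Ψ.lab e.1
  lab_bar e := Ψ.lab_bar e.1
  lab_typ e := Ψ.lab_typ e.1

end AGraph

variable {ι : Type} {G : ι → Type} [∀ i, Group (G i)]

/-- A subgroup of the free product `∗_i G i` is factor-free if it meets every conjugate
of every factor trivially. -/
def FactorFreeI (H : Subgroup (CoprodI G)) : Prop :=
  ∀ (s : CoprodI G) (i : ι),
    H ⊓ conjS s (CoprodI.of : G i →* CoprodI G).range = ⊥

/-- `Ψ` with base vertex `o` is an irreducible graph of the subgroup `H`:
`Ψ` is a finite connected irreducible `A`-graph, `o` is primary (and is the vertex of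
degree `1` if one exists), and a reduced word `W` lies in `H` iff it is the label of a
reduced path `p` closed at `o` with `|p| = 2|W|`. -/
def IsIrrGraphOf (Ψ : AGraph ι G) (o : Ψ.V) (H : Subgroup (CoprodI G)) : Prop :=
  Ψ.FiniteGraph ∧ Ψ.Connected ∧ Ψ.Irr ∧ Ψ.prim o ∧ (∀ v, Ψ.deg v = 1 → v = o) ∧
    ∀ w : CoprodI.Word G,
      (w.prod ∈ H ↔ ∃ p : List Ψ.E, Ψ.IsRedPath p ∧ Ψ.ClosedAt p o ∧
        Ψ.pathLabel p = w.prod ∧ p.length = 2 * w.toList.length)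

/-- `Ψ` is an irreducible core graph of `H`: the core of an irreducible graph of `H`. -/
def IsIrrCoreGraphOf (Ψ : AGraph ι G) (H : Subgroup (CoprodI G)) : Prop :=
  ∃ (Ψ₀ : AGraph ι G) (o : Ψ₀.V), IsIrrGraphOf Ψ₀ o H ∧ Ψ = Ψ₀.core

end Graphs

namespace Cardinal

theorem exists_equiv_extending {K X Y : Type} [Finite K] [Infinite X] {i : K → X} {j : K → Y}
    (hi : Function.Injective i) (hj : Function.Injective j) (h : Nonempty (X ≃ Y)) :
    ∃ g : X ≃ Y, ∀ k, g (i k) = j k := by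
  obtain ⟨g, hg⟩ := extend_function_of_lt (s := Set.range i)
    ((Equiv.ofInjective i hi).symm.toEmbedding.trans ⟨j, hj⟩)
    ((lt_aleph0_of_finite _).trans_le (aleph0_le_mk X)) h
  refine ⟨g, fun k => ?_⟩
  simpa [Equiv.ofInjective_symm_apply] using hg ⟨i k, k, rfl⟩

end Cardinal

/-- Left multiplication on the second coordinate, transported along an equivalence. -/
def transportedMulLeft {Z Y M : Type} [Group M] (φ : Z ≃ Y × M) : M →* Equiv.Perm Z where
  toFun g := φ.trans (((Equiv.refl Y).prodCongr (Equiv.mulLeft g)).trans φ.symm)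
  map_one' := by ext z; simp
  map_mul' g h := by ext z; simp [Prod.map]

theorem transportedMulLeft_apply {Z Y M : Type} [Group M] (φ : Z ≃ Y × M) (g : M) (z : Z) :
    transportedMulLeft φ g z = φ.symm ((φ z).1, g * (φ z).2) := rfl

theorem eq_one_of_transportedMulLeft_fixed {Z Y M : Type} [Group M] {φ : Z ≃ Y × M} {g : M}
    {z : Z} (h : transportedMulLeft φ g z = z) : g = 1 := by
  rw [transportedMulLeft_apply, Equiv.symm_apply_eq] at h
  simpa using congrArg Prod.snd h

theorem Sigma.eq_of_transport_snd_eq {ι : Type} {G : ι → Type} {i : ι} {a b : Σ i, G i}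
    (ha : a.1 = i) (hb : b.1 = i) (h : (ha ▸ a.2 : G i) = hb ▸ b.2) : a = b := by
  obtain ⟨_, _⟩ := a
  obtain ⟨_, _⟩ := b
  subst ha
  cases hb
  exact congrArg _ h

namespace AGraph

variable {ι : Type} {G : ι → Type} [∀ i, Group (G i)] {Ψ : AGraph ι G}

theorem ter_bar (e : Ψ.E) : Ψ.ter (Ψ.bar e) = Ψ.ini e := by
  rw [← Ψ.ini_bar, Ψ.bar_bar]

theorem prim_ini_bar (e : Ψ.E) : Ψ.prim (Ψ.ini (Ψ.bar e)) ↔ ¬ Ψ.prim (Ψ.ini e) := by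
  rw [Ψ.ini_bar, Ψ.bipartite e, not_not]

theorem of_lab_bar (e : Ψ.E) :
    (CoprodI.of (Ψ.lab (Ψ.bar e)).2 : CoprodI G) = (CoprodI.of (Ψ.lab e).2)⁻¹ := by
  rw [Ψ.lab_bar, map_inv]

/-- A finite irreducible graph with an `A`-valued voltage assignment `c` embeds, as a partial
action, into an action of the free product in which every factor acts freely. -/
theorem exists_action (hfin : Ψ.FiniteGraph) (hirr : Ψ.Irr) {A : Type} [AddGroup A] [Finite A]
    (c : Ψ.E → A) (hc : ∀ e, c (Ψ.bar e) = -c e) :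
    ∃ (Z : Type) (ρ : CoprodI G →* Equiv.Perm Z) (pt : Ψ.V → A → Z),
      (∀ (i : ι) (g : G i) (z : Z), ρ (CoprodI.of g) z = z → g = 1) ∧
      (∀ u, Function.Injective (pt u)) ∧
      ∀ e t, ρ (CoprodI.of (Ψ.lab e).2) (pt (Ψ.ter e) t) = pt (Ψ.ini e) (t + c e) := by
  classical
  obtain ⟨hV, hE⟩ := hfin
  obtain ⟨hP1, hP2, hP3, -⟩ := hirr
  let Z : Type := (Ψ.V × A) ⊕ (ℕ ⊕ (Σ i, G i))
  have key : ∀ i : ι, ∃ φ : Z ≃ Z × G i,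
      ∀ (k : {e : Ψ.E // Ψ.prim (Ψ.ini e) ∧ (Ψ.lab e).1 = i} × A),
        φ (Sum.inl (Ψ.ini k.1.1, k.2)) =
          (Sum.inl (Ψ.ter k.1.1, k.2 - c k.1.1), k.1.2.2 ▸ (Ψ.lab k.1.1).2) := by
    intro i
    refine Cardinal.exists_equiv_extending
      (i := fun k : {e : Ψ.E // Ψ.prim (Ψ.ini e) ∧ (Ψ.lab e).1 = i} × A =>
        (Sum.inl (Ψ.ini k.1.1, k.2) : Z))
      (j := fun k => ((Sum.inl (Ψ.ter k.1.1, k.2 - c k.1.1) : Z), k.1.2.2 ▸ (Ψ.lab k.1.1).2))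
      ?_ ?_ ?_
    · rintro ⟨⟨e, he, hei⟩, s⟩ ⟨⟨f, hf, hfi⟩, t⟩ h
      obtain ⟨h1, rfl⟩ : Ψ.ini e = Ψ.ini f ∧ s = t := by simpa using h
      have h2 : Ψ.ter e = Ψ.ter f := by
        by_contra hne
        refine hP1 e f h1 he hne ?_
        rw [← Ψ.lab_typ e ((Ψ.bipartite e).1 he), ← Ψ.lab_typ f ((Ψ.bipartite f).1 hf), hei, hfi]
      simp [hP3 e f h1 h2]
    · rintro ⟨⟨e, he, hei⟩, s⟩ ⟨⟨f, hf, hfi⟩, t⟩ h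
      obtain ⟨⟨h1, h2⟩, h3⟩ := by
        simpa only [Prod.mk.injEq, Sum.inl.injEq] using h
      have hlab : Ψ.lab e = Ψ.lab f := Sigma.eq_of_transport_snd_eq hei hfi h3
      have hef : e = f := by
        by_contra hne
        exact hP2 e f hne h1 ((Ψ.bipartite e).1 he) hlab
      subst hef
      simpa using h2
    · refine Cardinal.eq.1 ?_
      rw [← Cardinal.mul_def]
      refine (Cardinal.mul_eq_left (Cardinal.aleph0_le_mk Z) ?_ (Cardinal.mk_ne_zero _)).symm
      exact Cardinal.mk_le_of_injective
        (f := fun g : G i => (Sum.inr (Sum.inr ⟨i, g⟩) : Z)) fun a b h => by simpa [Z] using h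
  choose φ hφ using key
  let ρ : CoprodI G →* Equiv.Perm Z := CoprodI.lift fun i => transportedMulLeft (φ i)
  let pt : Ψ.V → A → Z := fun u t =>
    if Ψ.prim u then Sum.inl (u, t) else (φ (Ψ.typ u)).symm (Sum.inl (u, t), 1)
  have hρ : ∀ (i : ι) (g : G i), ρ (CoprodI.of g) = transportedMulLeft (φ i) g := fun i g =>
    CoprodI.lift_of _ g
  have hpos : ∀ e t, Ψ.prim (Ψ.ini e) →
      ρ (CoprodI.of (Ψ.lab e).2) (pt (Ψ.ter e) t) = pt (Ψ.ini e) (t + c e) := by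
    intro e t he
    have hs := (Ψ.bipartite e).1 he
    have hpt : pt (Ψ.ter e) t = (φ (Ψ.lab e).1).symm (Sum.inl (Ψ.ter e, t), 1) := by
      simp only [pt, if_neg hs]
      rw [Ψ.lab_typ e hs]
    rw [hpt, hρ, transportedMulLeft_apply, Equiv.symm_apply_eq]
    simpa [pt, he] using (hφ (Ψ.lab e).1 (⟨e, he, rfl⟩, t + c e)).symm
  refine ⟨Z, ρ, pt, fun i g z h => ?_, fun u s t h => ?_, fun e t => ?_⟩
  · rw [hρ] at h
    exact eq_one_of_transportedMulLeft_fixed h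
  · by_cases hu : Ψ.prim u <;> simpa [pt, hu, Z] using h
  · by_cases he : Ψ.prim (Ψ.ini e)
    · exact hpos e t he
    · have h := hpos (Ψ.bar e) (t + c e) ((prim_ini_bar e).2 he)
      rw [of_lab_bar, ter_bar, Ψ.ini_bar, hc, map_inv, Equiv.Perm.inv_eq_iff_eq] at h
      simpa using h.symm

/-- `p` is a walk from `u` to `v`. -/
def IsWalk (Ψ : AGraph ι G) : List Ψ.E → Ψ.V → Ψ.V → Prop
  | [], u, v => u = v
  | e :: p, u, v => Ψ.ini e = u ∧ Ψ.IsWalk p (Ψ.ter e) v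

theorem isWalk_append {p q : List Ψ.E} {u v w : Ψ.V} (hp : Ψ.IsWalk p u v)
    (hq : Ψ.IsWalk q v w) : Ψ.IsWalk (p ++ q) u w := by
  induction p generalizing u with
  | nil => cases hp; exact hq
  | cons e p ih => exact ⟨hp.1, ih hp.2⟩

theorem isWalk_singleton (e : Ψ.E) : Ψ.IsWalk [e] (Ψ.ini e) (Ψ.ter e) := ⟨rfl, rfl⟩

theorem pathLabel_nil : Ψ.pathLabel [] = 1 := rfl

theorem pathLabel_append (p q : List Ψ.E) :
    Ψ.pathLabel (p ++ q) = Ψ.pathLabel p * Ψ.pathLabel q := by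
  simp [pathLabel]

theorem pathLabel_cons (e : Ψ.E) (p : List Ψ.E) :
    Ψ.pathLabel (e :: p) = CoprodI.of (Ψ.lab e).2 * Ψ.pathLabel p := by
  simp [pathLabel]

theorem pathLabel_singleton (e : Ψ.E) : Ψ.pathLabel [e] = CoprodI.of (Ψ.lab e).2 := by
  simp [pathLabel]

theorem isWalk_reverse {p : List Ψ.E} {u v : Ψ.V} (hp : Ψ.IsWalk p u v) :
    Ψ.IsWalk (p.map Ψ.bar).reverse v u := by
  induction p generalizing u with
  | nil => exact Eq.symm hp
  | cons e p ih =>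
    obtain ⟨rfl, hp⟩ := hp
    rw [List.map_cons, List.reverse_cons]
    refine isWalk_append (ih hp) ?_
    simpa only [Ψ.ini_bar, ter_bar] using isWalk_singleton (Ψ.bar e)

theorem pathLabel_reverse (p : List Ψ.E) :
    Ψ.pathLabel (p.map Ψ.bar).reverse = (Ψ.pathLabel p)⁻¹ := by
  induction p with
  | nil => simp [pathLabel]
  | cons e p ih =>
    rw [List.map_cons, List.reverse_cons, pathLabel_append, ih, pathLabel_cons e,
      pathLabel_singleton, of_lab_bar, mul_inv_rev]

theorem isPath_iff {p : List Ψ.E} :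
    Ψ.IsPath p ↔ p.IsChain fun e f => Ψ.ter e = Ψ.ini f := Iff.rfl

theorem isWalk_iff {p : List Ψ.E} {u v : Ψ.V} :
    Ψ.IsWalk p u v ↔ Ψ.IsPath p ∧ (p = [] → u = v) ∧
      (∀ e ∈ p.head?, Ψ.ini e = u) ∧ (∀ e ∈ p.getLast?, Ψ.ter e = v) := by
  induction p generalizing u with
  | nil => simp [IsWalk, isPath_iff]
  | cons e p ih =>
    rw [IsWalk, ih]
    cases p with
    | nil => simp [isPath_iff]
    | cons f p =>
      simp only [isPath_iff, List.isChain_cons_cons, List.head?_cons, List.getLast?_cons_cons,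
        Option.mem_some_iff, forall_eq', reduceCtorEq, false_implies, true_and]
      constructor
      · rintro ⟨h1, h2, h3, h4⟩
        exact ⟨⟨h3.symm, h2⟩, h1, h4⟩
      · rintro ⟨⟨h3, h2⟩, h1, h4⟩
        exact ⟨h1, h2, h3.symm, h4⟩

theorem isWalk_self_iff {p : List Ψ.E} {v : Ψ.V} :
    Ψ.IsWalk p v v ↔ Ψ.IsPath p ∧ Ψ.ClosedAt p v := by
  simp [isWalk_iff, ClosedAt]

theorem action_walk {A Z : Type} [AddCommGroup A] {c : Ψ.E → A}
    {ρ : CoprodI G →* Equiv.Perm Z} {pt : Ψ.V → A → Z}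
    (h : ∀ e t, ρ (CoprodI.of (Ψ.lab e).2) (pt (Ψ.ter e) t) = pt (Ψ.ini e) (t + c e))
    {p : List Ψ.E} {u v : Ψ.V} (hp : Ψ.IsWalk p u v) (t : A) :
    ρ (Ψ.pathLabel p) (pt v t) = pt u (t + (p.map c).sum) := by
  induction p generalizing u with
  | nil => cases hp; simp [pathLabel]
  | cons e p ih =>
    obtain ⟨rfl, hp⟩ := hp
    rw [pathLabel_cons, map_mul, Equiv.Perm.mul_apply, ih hp, h, List.map_cons, List.sum_cons,
      add_assoc, add_comm (c e)]

theorem exists_walk (hconn : Ψ.Connected) (u v : Ψ.V) : ∃ p, Ψ.IsWalk p u v := by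
  induction hconn u v with
  | refl => exact ⟨[], rfl⟩
  | tail _ h ih =>
    obtain ⟨p, hp⟩ := ih
    obtain ⟨e, rfl, rfl⟩ := h
    exact ⟨p ++ [e], isWalk_append hp (isWalk_singleton e)⟩

/-- A connected graph has a spanning tree rooted at `o`: each vertex `v ≠ o` has a parent edge
`par v` coming from a vertex of smaller depth. -/
theorem exists_parent (hconn : Ψ.Connected) (o : Ψ.V) :
    ∃ (d : Ψ.V → ℕ) (par : {v // v ≠ o} → Ψ.E),
      ∀ v, Ψ.ter (par v) = v.1 ∧ d (Ψ.ini (par v)) < d v.1 := by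
  classical
  have hd : ∀ v, ∃ n, ∃ p, Ψ.IsWalk p v o ∧ p.length = n := fun v =>
    let ⟨p, hp⟩ := exists_walk hconn v o
    ⟨_, p, hp, rfl⟩
  have key : ∀ v : {v // v ≠ o}, ∃ e : Ψ.E,
      Ψ.ter e = v.1 ∧ Nat.find (hd (Ψ.ini e)) < Nat.find (hd v.1) := by
    rintro ⟨v, hv⟩
    obtain ⟨p, hp, hlen⟩ := Nat.find_spec (hd v)
    cases p with
    | nil => exact (hv hp).elim
    | cons e p =>
      refine ⟨Ψ.bar e, by rw [ter_bar, hp.1], ?_⟩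
      rw [Ψ.ini_bar, ← hlen]
      exact (Nat.find_min' _ ⟨p, hp.2, rfl⟩).trans_lt (by simp)
  choose par hpar using key
  exact ⟨fun v => Nat.find (hd v), par, hpar⟩

section SpanningTree

variable {o : Ψ.V} {d : Ψ.V → ℕ} {par : {v // v ≠ o} → Ψ.E}

open Classical in
/-- The path from the root `o` to a vertex in the spanning tree given by `par`. -/
noncomputable def treePath (hpar : ∀ v, Ψ.ter (par v) = v.1 ∧ d (Ψ.ini (par v)) < d v.1)
    (v : Ψ.V) : List Ψ.E :=
  if h : v = o then [] else treePath hpar (Ψ.ini (par ⟨v, h⟩)) ++ [par ⟨v, h⟩]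
termination_by d v
decreasing_by exact (hpar ⟨v, h⟩).2

section Loops

variable (hpar : ∀ v, Ψ.ter (par v) = v.1 ∧ d (Ψ.ini (par v)) < d v.1)

theorem treePath_root : treePath hpar o = [] := by
  rw [treePath, dif_pos rfl]

theorem treePath_of_ne (v : {v // v ≠ o}) :
    treePath hpar v.1 = treePath hpar (Ψ.ini (par v)) ++ [par v] := by
  rw [treePath, dif_neg v.2]

theorem treePath_spec (v : Ψ.V) :
    Ψ.IsWalk (treePath hpar v) o v ∧ ∀ e ∈ treePath hpar v, ∃ w, par w = e := by
  induction hn : d v using Nat.strong_induction_on generalizing v with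
  | _ n ih =>
    subst hn
    by_cases h : v = o
    · subst h
      rw [treePath_root]
      exact ⟨rfl, by simp⟩
    · rw [treePath_of_ne hpar ⟨v, h⟩]
      obtain ⟨hv, hlt⟩ := hpar ⟨v, h⟩
      obtain ⟨h1, h2⟩ := ih _ hlt _ rfl
      refine ⟨isWalk_append h1 ⟨rfl, hv⟩, fun e he => ?_⟩
      rcases List.mem_append.1 he with he | he
      · exact h2 e he
      · exact ⟨_, (List.mem_singleton.1 he).symm⟩

/-- The closed path at `o` that follows the tree, traverses `e` and returns along the tree. -/
noncomputable def treeLoop (e : Ψ.E) : List Ψ.E :=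
  treePath hpar (Ψ.ini e) ++ ([e] ++ ((treePath hpar (Ψ.ter e)).map Ψ.bar).reverse)

theorem isWalk_treeLoop (e : Ψ.E) : Ψ.IsWalk (treeLoop hpar e) o o :=
  isWalk_append (treePath_spec hpar _).1
    (isWalk_append (isWalk_singleton e) (isWalk_reverse (treePath_spec hpar _).1))

theorem pathLabel_treeLoop (e : Ψ.E) : Ψ.pathLabel (treeLoop hpar e) =
    Ψ.pathLabel (treePath hpar (Ψ.ini e)) *
      (CoprodI.of (Ψ.lab e).2 * (Ψ.pathLabel (treePath hpar (Ψ.ter e)))⁻¹) := by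
  rw [treeLoop, pathLabel_append, pathLabel_append, pathLabel_singleton, pathLabel_reverse]

theorem pathLabel_treeLoop_bar (e : Ψ.E) :
    Ψ.pathLabel (treeLoop hpar (Ψ.bar e)) = (Ψ.pathLabel (treeLoop hpar e))⁻¹ := by
  rw [pathLabel_treeLoop, pathLabel_treeLoop, ter_bar, Ψ.ini_bar, of_lab_bar]
  group

theorem pathLabel_treeLoop_parent (v : {v // v ≠ o}) :
    Ψ.pathLabel (treeLoop hpar (par v)) = 1 := by
  rw [pathLabel_treeLoop, (hpar v).1, treePath_of_ne hpar v, pathLabel_append,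
    pathLabel_singleton]
  group

theorem sum_treeLoop {A : Type} [AddCommGroup A] {c : Ψ.E → A}
    (hc : ∀ e, c (Ψ.bar e) = -c e) (hpar0 : ∀ v, c (par v) = 0) (e : Ψ.E) :
    ((treeLoop hpar e).map c).sum = c e := by
  have hzero : ∀ v, ∀ x ∈ treePath hpar v, c x = 0 := fun v x hx => by
    obtain ⟨w, rfl⟩ := (treePath_spec hpar v).2 x hx
    exact hpar0 w
  have h1 : ((treePath hpar (Ψ.ini e)).map c).sum = 0 :=
    List.sum_eq_zero (by simpa using hzero (Ψ.ini e))
  have h2 : ((((treePath hpar (Ψ.ter e)).map Ψ.bar).reverse).map c).sum = 0 :=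
    List.sum_eq_zero (by simpa [hc] using hzero (Ψ.ter e))
  simp only [treeLoop, List.map_append, List.sum_append, h1, h2]
  simp

/-- The edges outside the spanning tree, oriented away from their primary vertex. -/
abbrev CoTree (par : {v // v ≠ o} → Ψ.E) : Type :=
  {e : {e : Ψ.E // Ψ.prim (Ψ.ini e)} // ¬ ∃ v, par v = e.1 ∨ par v = Ψ.bar e.1}

theorem pathLabel_mem_closure_treeLoop {p : List Ψ.E} {u v : Ψ.V} (hp : Ψ.IsWalk p u v) :
    Ψ.pathLabel (treePath hpar u) * Ψ.pathLabel p * (Ψ.pathLabel (treePath hpar v))⁻¹ ∈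
      Subgroup.closure
        (Set.range fun k : CoTree par => Ψ.pathLabel (treeLoop hpar k.1.1)) := by
  set C := Subgroup.closure
    (Set.range fun k : CoTree par => Ψ.pathLabel (treeLoop hpar k.1.1))
  have hpos : ∀ e, Ψ.prim (Ψ.ini e) → Ψ.pathLabel (treeLoop hpar e) ∈ C := by
    intro e he
    by_cases h : ∃ v, par v = e ∨ par v = Ψ.bar e
    · obtain ⟨v, rfl | h⟩ := h
      · rw [pathLabel_treeLoop_parent]
        exact C.one_mem
      · rw [← inv_mem_iff, ← pathLabel_treeLoop_bar, ← h, pathLabel_treeLoop_parent]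
        exact C.one_mem
    · exact Subgroup.subset_closure ⟨⟨⟨e, he⟩, h⟩, rfl⟩
  have hall : ∀ e, Ψ.pathLabel (treeLoop hpar e) ∈ C := by
    intro e
    by_cases he : Ψ.prim (Ψ.ini e)
    · exact hpos e he
    · rw [← inv_mem_iff, ← pathLabel_treeLoop_bar]
      exact hpos _ ((prim_ini_bar e).2 he)
  induction p generalizing u with
  | nil =>
    cases hp
    simp [pathLabel, C.one_mem]
  | cons e p ih =>
    obtain ⟨rfl, hp⟩ := hp
    convert C.mul_mem (hall e) (ih hp) using 1
    rw [pathLabel_treeLoop, pathLabel_cons]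
    group

end Loops

theorem parent_ne_bar_parent
    (hpar : ∀ v, Ψ.ter (par v) = v.1 ∧ d (Ψ.ini (par v)) < d v.1)
    (v w : {v // v ≠ o}) : par v ≠ Ψ.bar (par w) := by
  intro h
  have h1 := (hpar v).2
  have h2 := (hpar w).2
  rw [← (hpar v).1] at h1
  rw [← (hpar w).1] at h2
  rw [h, Ψ.ini_bar, ter_bar] at h1
  exact lt_asymm h1 h2

theorem card_edges [Finite Ψ.E] :
    Nat.card Ψ.E = 2 * Nat.card {e : Ψ.E // Ψ.prim (Ψ.ini e)} := by
  classical
  have e1 : {e : Ψ.E // ¬ Ψ.prim (Ψ.ini e)} ≃ {e : Ψ.E // Ψ.prim (Ψ.ini e)} :=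
    { toFun := fun e => ⟨Ψ.bar e.1, (prim_ini_bar e.1).2 e.2⟩
      invFun := fun e => ⟨Ψ.bar e.1, fun h => (prim_ini_bar e.1).1 h e.2⟩
      left_inv := fun e => Subtype.ext (Ψ.bar_bar e.1)
      right_inv := fun e => Subtype.ext (Ψ.bar_bar e.1) }
  rw [← Nat.card_congr (Equiv.sumCompl fun e : Ψ.E => Ψ.prim (Ψ.ini e)), Nat.card_sum,
    Nat.card_congr e1, two_mul]

theorem card_coTree (hpar : ∀ v, Ψ.ter (par v) = v.1 ∧ d (Ψ.ini (par v)) < d v.1)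
    (hfin : Ψ.FiniteGraph) :
    Nat.card (CoTree par) + Nat.card Ψ.V = Nat.card {e : Ψ.E // Ψ.prim (Ψ.ini e)} + 1 := by
  classical
  obtain ⟨hV, hE⟩ := hfin
  let P : {e : Ψ.E // Ψ.prim (Ψ.ini e)} → Prop :=
    fun e => ∃ v, par v = e.1 ∨ par v = Ψ.bar e.1
  let f : {v // v ≠ o} → {e // P e} := fun v =>
    if h : Ψ.prim (Ψ.ini (par v)) then ⟨⟨par v, h⟩, v, Or.inl rfl⟩
    else ⟨⟨Ψ.bar (par v), (prim_ini_bar _).2 h⟩, v, Or.inr (Ψ.bar_bar _).symm⟩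
  have hinj : Function.Injective par := fun v w h =>
    Subtype.ext (by rw [← (hpar v).1, h, (hpar w).1])
  have hf : Function.Bijective f := by
    constructor
    · intro v w h
      by_cases hv : Ψ.prim (Ψ.ini (par v)) <;> by_cases hw : Ψ.prim (Ψ.ini (par w)) <;>
        simp only [f, hv, hw, dif_pos, dif_neg, not_false_eq_true, Subtype.mk.injEq] at h
      · exact hinj h
      · exact (parent_ne_bar_parent hpar v w h).elim
      · exact (parent_ne_bar_parent hpar w v h.symm).elim
      · exact hinj (by rw [← Ψ.bar_bar (par v), h, Ψ.bar_bar])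
    · rintro ⟨⟨e, he⟩, v, hv⟩
      refine ⟨v, Subtype.ext (Subtype.ext ?_)⟩
      dsimp only at hv
      rcases hv with hv | hv
      · have h : Ψ.prim (Ψ.ini (par v)) := hv ▸ he
        simp only [f, dif_pos h, hv]
      · have h : ¬ Ψ.prim (Ψ.ini (par v)) := by
          rw [hv, prim_ini_bar, not_not]
          exact he
        simp only [f, dif_neg h, hv, Ψ.bar_bar]
  have h1 := Nat.card_congr (Equiv.sumCompl P)
  have h2 := Nat.card_congr (Equiv.sumCompl fun v : Ψ.V => v = o)
  rw [Nat.card_sum] at h1 h2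
  rw [← Nat.card_congr (Equiv.ofBijective f hf)] at h1
  have h3 : Nat.card {v : Ψ.V // v = o} = 1 := Nat.card_unique
  change Nat.card {e // ¬ P e} + _ = _
  change _ + Nat.card {v : Ψ.V // v ≠ o} = _ at h2
  omega

theorem card_coTree_le_of_closure_eq
    (hpar : ∀ v, Ψ.ter (par v) = v.1 ∧ d (Ψ.ini (par v)) < d v.1)
    (hfin : Ψ.FiniteGraph) (hirr : Ψ.Irr)
    {H : Subgroup (CoprodI G)} (hH : ∀ w, w ∈ H ↔ ∃ p, Ψ.IsWalk p o o ∧ Ψ.pathLabel p = w)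
    (S : Finset (CoprodI G)) (hS : Subgroup.closure (S : Set (CoprodI G)) = H) :
    Nat.card (CoTree par) ≤ S.card := by
  classical
  have := hfin.1
  have := hfin.2
  have : Fintype (CoTree par) := Fintype.ofFinite _
  have : Fact (Nat.Prime 2) := ⟨Nat.prime_two⟩
  let c : Ψ.E → CoTree par → ZMod 2 :=
    fun e k => if k.1.1 = e ∨ k.1.1 = Ψ.bar e then 1 else 0
  have hc : ∀ e, c (Ψ.bar e) = -c e := by
    intro e
    ext k
    simp only [c, Pi.neg_apply, CharTwo.neg_eq, Ψ.bar_bar, or_comm]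
  have hpar0 : ∀ v, c (par v) = 0 := by
    intro v
    ext k
    refine if_neg fun h => k.2 ⟨v, ?_⟩
    rcases h with h | h
    · exact Or.inl h.symm
    · exact Or.inr (by rw [h, Ψ.bar_bar])
  have hcs : ∀ k : CoTree par, c k.1.1 = Pi.single k 1 := by
    intro k
    ext l
    have hne : l.1.1 ≠ Ψ.bar k.1.1 := fun h => (prim_ini_bar k.1.1).1 (h ▸ l.1.2) k.1.2
    simp [c, hne, Pi.single_apply, Subtype.ext_iff]
  obtain ⟨Z, ρ, pt, -, hpt, hstep⟩ := exists_action hfin hirr c hc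
  have hmem : ∀ w ∈ H, ∃ a : CoTree par → ZMod 2, ∀ t, ρ w (pt o t) = pt o (t + a) := by
    intro w hw
    obtain ⟨p, hp, rfl⟩ := (hH w).1 hw
    exact ⟨_, action_walk hstep hp⟩
  have hmemS : ∀ w : S, w.1 ∈ H := fun w => hS ▸ Subgroup.subset_closure w.2
  choose κ hκ using fun w : S => hmem w.1 (hmemS w)
  have hspan : ∀ w ∈ Subgroup.closure (S : Set (CoprodI G)),
      ∃ a ∈ Submodule.span (ZMod 2) (Set.range κ), ∀ t, ρ w (pt o t) = pt o (t + a) := by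
    intro w hw
    induction hw using Subgroup.closure_induction with
    | mem x hx => exact ⟨κ ⟨x, hx⟩, Submodule.subset_span ⟨_, rfl⟩, hκ ⟨x, hx⟩⟩
    | one => exact ⟨0, Submodule.zero_mem _, by simp⟩
    | mul x y _ _ hx hy =>
      obtain ⟨a, ha, hxa⟩ := hx
      obtain ⟨b, hb, hyb⟩ := hy
      refine ⟨b + a, Submodule.add_mem _ hb ha, fun t => ?_⟩
      rw [map_mul, Equiv.Perm.mul_apply, hyb, hxa, add_assoc]
    | inv x _ hx =>
      obtain ⟨a, ha, hxa⟩ := hx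
      refine ⟨-a, Submodule.neg_mem _ ha, fun t => ?_⟩
      rw [map_inv, Equiv.Perm.inv_eq_iff_eq, hxa, neg_add_cancel_right]
  have htop : Submodule.span (ZMod 2) (Set.range κ) = ⊤ := by
    rw [eq_top_iff, ← (Pi.basisFun (ZMod 2) (CoTree par)).span_eq, Submodule.span_le]
    rintro _ ⟨k, rfl⟩
    obtain ⟨a, ha, hwa⟩ := hspan (Ψ.pathLabel (treeLoop hpar k.1.1))
      (hS ▸ (hH _).2 ⟨_, isWalk_treeLoop hpar _, rfl⟩)
    have h := (hwa 0).symm.trans (action_walk hstep (isWalk_treeLoop hpar k.1.1) 0)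
    rw [sum_treeLoop hpar hc hpar0, hcs] at h
    have h' := hpt o h
    rw [zero_add, zero_add] at h'
    rw [Pi.basisFun_apply, ← h']
    exact ha
  have h := finrank_range_le_card (R := ZMod 2) κ
  rw [Set.finrank, htop, finrank_top, Module.finrank_pi] at h
  simpa [Nat.card_eq_fintype_card] using h

theorem rk_eq_card_coTree
    (hpar : ∀ v, Ψ.ter (par v) = v.1 ∧ d (Ψ.ini (par v)) < d v.1)
    (hfin : Ψ.FiniteGraph) (hirr : Ψ.Irr)
    {H : Subgroup (CoprodI G)} (hH : ∀ w, w ∈ H ↔ ∃ p, Ψ.IsWalk p o o ∧ Ψ.pathLabel p = w) :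
    rk H = Nat.card (CoTree par) := by
  classical
  have := hfin.2
  have : Fintype (CoTree par) := Fintype.ofFinite _
  let gen : CoTree par → CoprodI G := fun k => Ψ.pathLabel (treeLoop hpar k.1.1)
  have hgen : Subgroup.closure ((Finset.univ.image gen : Finset _) : Set (CoprodI G)) = H := by
    rw [Finset.coe_image, Finset.coe_univ, Set.image_univ]
    apply le_antisymm
    · rw [Subgroup.closure_le]
      rintro _ ⟨k, rfl⟩
      exact (hH _).2 ⟨_, isWalk_treeLoop hpar _, rfl⟩
    · intro w hw
      obtain ⟨p, hp, rfl⟩ := (hH w).1 hw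
      have h := pathLabel_mem_closure_treeLoop hpar hp
      rwa [treePath_root, pathLabel_nil, one_mul, inv_one, mul_one] at h
  apply le_antisymm
  · calc rk H ≤ (Finset.univ.image gen).card := Nat.sInf_le ⟨_, rfl, hgen⟩
      _ ≤ Nat.card (CoTree par) := by
        rw [Nat.card_eq_fintype_card]
        exact Finset.card_image_le
  · refine le_csInf ⟨_, _, rfl, hgen⟩ ?_
    rintro _ ⟨S, rfl, hS⟩
    exact card_coTree_le_of_closure_eq hpar hfin hirr hH S hS

end SpanningTree

theorem two_mul_card_vertices_le (hfin : Ψ.FiniteGraph) (hirr : Ψ.Irr) :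
    2 * Nat.card Ψ.V ≤ Nat.card Ψ.E + 1 := by
  classical
  obtain ⟨hV, hE⟩ := hfin
  obtain ⟨-, -, -, hpos, huniq, -⟩ := hirr
  have : Fintype Ψ.V := Fintype.ofFinite _
  have : Fintype Ψ.E := Fintype.ofFinite _
  have hsum : ∑ v, Ψ.deg v = Nat.card Ψ.E := by
    rw [Nat.card_eq_fintype_card, ← Finset.card_univ,
      Finset.card_eq_sum_card_fiberwise (f := Ψ.ter) (t := Finset.univ) (by simp)]
    refine Finset.sum_congr rfl fun v _ => ?_
    rw [deg, ← Set.ncard_coe_finset]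
    simp
  have hone : ∑ v, (if Ψ.deg v = 1 then 1 else 0) ≤ 1 := by
    rw [← Finset.card_filter, Finset.card_le_one]
    intro v hv w hw
    exact huniq v w (by simpa using hv) (by simpa using hw)
  have hle : ∑ _v : Ψ.V, 2 ≤ ∑ v, (Ψ.deg v + if Ψ.deg v = 1 then 1 else 0) := by
    refine Finset.sum_le_sum fun v _ => ?_
    have := hpos v
    split_ifs <;> omega
  rw [Finset.sum_add_distrib, hsum, Finset.sum_const, Finset.card_univ, smul_eq_mul,
    ← Nat.card_eq_fintype_card] at hle
  omega

theorem factorFreeI_of_closed_paths (hfin : Ψ.FiniteGraph) (hirr : Ψ.Irr) {o : Ψ.V}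
    {H : Subgroup (CoprodI G)} (hH : ∀ w, w ∈ H ↔ ∃ p, Ψ.IsWalk p o o ∧ Ψ.pathLabel p = w) :
    FactorFreeI H := by
  obtain ⟨Z, ρ, pt, hfree, -, hstep⟩ :=
    exists_action hfin hirr (A := PUnit) (fun _ => 0) (fun _ => rfl)
  intro s i
  rw [eq_bot_iff]
  rintro w ⟨hw, hs⟩
  obtain ⟨p, hp, rfl⟩ := (hH w).1 hw
  obtain ⟨_, ⟨g, rfl⟩, hg⟩ := hs
  have h := action_walk hstep hp 0
  have hg' : s * CoprodI.of g * s⁻¹ = Ψ.pathLabel p := hg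
  rw [← hg', map_mul, map_mul, map_inv, Equiv.Perm.mul_apply, Equiv.Perm.mul_apply,
    ← Equiv.Perm.eq_inv_iff_eq] at h
  have hg1 : g = 1 := hfree i g _ h
  rw [Subgroup.mem_bot, ← hg', hg1]
  simp

end AGraph

/-- Lemma 2: if `Ψ` is a finite connected irreducible `A`-graph with base
vertex `o` and `H` is the subgroup of the free product consisting of the labels of all
paths closed at `o`, then `H` is factor-free and `r̄(H) = -χ(Ψ) = |EΨ|/2 - |VΨ|`. -/
theorem statement8 {ι : Type} {G : ι → Type} [∀ i, Group (G i)]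
    [∀ i, Nontrivial (G i)]
    (Ψ : AGraph ι G) (o : Ψ.V) (hfin : Ψ.FiniteGraph) (hconn : Ψ.Connected)
    (hirr : Ψ.Irr) (ho : Ψ.prim o)
    (H : Subgroup (CoprodI G))
    (hH : (H : Set (CoprodI G)) =
      {w | ∃ p : List Ψ.E, Ψ.IsPath p ∧ Ψ.ClosedAt p o ∧ Ψ.pathLabel p = w}) :
    FactorFreeI H ∧
      2 * (rrk H : ℤ) = (Nat.card Ψ.E : ℤ) - 2 * (Nat.card Ψ.V : ℤ) := by
  have hH' : ∀ w, w ∈ H ↔ ∃ p, Ψ.IsWalk p o o ∧ Ψ.pathLabel p = w := by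
    intro w
    rw [← SetLike.mem_coe, hH]
    simp only [Set.mem_ofPred_eq, AGraph.isWalk_self_iff, and_assoc]
  refine ⟨AGraph.factorFreeI_of_closed_paths hfin hirr hH', ?_⟩
  obtain ⟨d, par, hpar⟩ := AGraph.exists_parent hconn o
  have := hfin.2
  have h1 := AGraph.card_coTree hpar hfin
  have h2 := AGraph.card_edges (Ψ := Ψ)
  have h3 := AGraph.two_mul_card_vertices_le hfin hirr
  rw [rrk, AGraph.rk_eq_card_coTree hpar hfin hirr hH']
  omega
end

section
/- Let G be a group, d ≥ 3 an integer, C a finite subset of G with |C| = d² + d, and T′ a finite subset of G with 2 ≤ |T′| ≤ d. Suppose T′ = E_1 ∪ ⋯ ∪ E_r is a partition of T′ into nonempty pairwise disjoint subsets. Then there exist elements h_1, …, h_r ∈ G such that the right translates E_1h_1, …, E_rh_r are pairwise disjoint — equivalently, the set T := E_1h_1 ∪ ⋯ ∪ E_rh_r has cardinality |T| = |T′| — and every set E_ih_i, i = 1, …, r, contains an element of C. -/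
/-- If `|E| * |U| < |C|`, some right translate of `E` meets `C` and avoids `U`. -/
theorem exists_image_mul_right_disjoint {G : Type*} [Group G] [DecidableEq G]
    {E U C : Finset G} (hE : E.Nonempty) (hC : E.card * U.card < C.card) :
    ∃ g : G, Disjoint (E.image (· * g)) U ∧ ∃ c ∈ C, c ∈ E.image (· * g) := by
  obtain ⟨e, he⟩ := hE
  have hcard : (Finset.image₂ (fun x u => x⁻¹ * u) E U).card < (C.image (e⁻¹ * ·)).card := by
    rw [Finset.card_image_of_injective _ (mul_right_injective e⁻¹)]
    exact (Finset.card_image₂_le _ _ _).trans_lt hC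
  obtain ⟨g, hg, hgU⟩ := Finset.exists_mem_notMem_of_card_lt_card hcard
  obtain ⟨c, hc, rfl⟩ := Finset.mem_image.1 hg
  refine ⟨e⁻¹ * c, Finset.disjoint_left.2 fun y hy hyU => hgU ?_, c, hc,
    Finset.mem_image.2 ⟨e, he, mul_inv_cancel_left e c⟩⟩
  obtain ⟨x, hx, rfl⟩ := Finset.mem_image.1 hy
  exact Finset.mem_image₂.2 ⟨x, hx, _, hyU, inv_mul_cancel_left x _⟩

/-- Finitely many nonempty sets whose total size squared is less than `|C|` have pairwise disjoint
right translates that all meet `C`. -/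
theorem exists_pairwiseDisjoint_image_mul_right {G ι : Type*} [Group G] [DecidableEq G]
    (C : Finset G) (E : ι → Finset G) (hne : ∀ i, (E i).Nonempty)
    (s : Finset ι) (hC : (∑ i ∈ s, (E i).card) ^ 2 < C.card) :
    ∃ h : ι → G, (s : Set ι).PairwiseDisjoint (fun i => (E i).image (· * h i)) ∧
      ∀ i ∈ s, ∃ c ∈ C, c ∈ (E i).image (· * h i) := by
  classical
  induction s using Finset.induction_on with
  | empty => exact ⟨1, by simp, by simp⟩
  | insert a s ha ih =>
    rw [Finset.sum_insert ha] at hC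
    obtain ⟨h, hdis, hmem⟩ := ih ((Nat.pow_le_pow_left (Nat.le_add_left _ _) 2).trans_lt hC)
    have hU : (s.biUnion fun i => (E i).image (· * h i)).card ≤ ∑ i ∈ s, (E i).card :=
      Finset.card_biUnion_le.trans (Finset.sum_le_sum fun i _ => Finset.card_image_le)
    obtain ⟨g, hgU, hgC⟩ := exists_image_mul_right_disjoint (C := C)
      (U := s.biUnion fun i => (E i).image (· * h i)) (hne a) (by nlinarith)
    have hs : ∀ i ∈ s, Function.update h a g i = h i := fun i hi =>
      Function.update_of_ne (ne_of_mem_of_not_mem hi ha) _ _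
    refine ⟨Function.update h a g, ?_, ?_⟩
    · rw [Finset.coe_insert, Set.pairwiseDisjoint_insert_of_notMem (by simpa using ha)]
      refine ⟨fun i hi j hj hij => ?_, fun j hj => ?_⟩
      · simpa only [Function.onFun, hs i hi, hs j hj] using hdis hi hj hij
      · simpa only [Function.update_self, hs j hj] using
          (Finset.disjoint_biUnion_right _ _ _).1 hgU j hj
    · intro i hi
      rcases Finset.mem_insert.1 hi with rfl | hi
      · simpa only [Function.update_self] using hgC
      · simpa only [hs i hi] using hmem i hi


/-- Lemma 6.3: let `G` be a group, `d ≥ 3`, `C ⊆ G` with `|C| = d² + d`,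
and let `T′ ⊆ G` with `2 ≤ |T′| ≤ d` be partitioned into nonempty pairwise disjoint
subsets `E_1, …, E_r`. Then there are `h_1, …, h_r ∈ G` such that the right translates
`E_1h_1, …, E_rh_r` are pairwise disjoint — equivalently, `T := E_1h_1 ∪ ⋯ ∪ E_rh_r`
has cardinality `|T| = |T′|` — and each `E_ih_i` contains an element of `C`. -/
theorem statement16 {G : Type} [Group G] [DecidableEq G]
    (d : ℕ) (hd : 3 ≤ d) (C : Finset G) (hC : C.card = d ^ 2 + d)
    (T' : Finset G) (hT'lb : 2 ≤ T'.card) (hT'ub : T'.card ≤ d)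
    (r : ℕ) (E : Fin r → Finset G)
    (hne : ∀ i, (E i).Nonempty)
    (hdisj : ∀ i j, i ≠ j → Disjoint (E i) (E j))
    (hpart : T' = Finset.univ.biUnion E) :
    ∃ h : Fin r → G,
      (∀ i j, i ≠ j →
        Disjoint ((E i).image (· * h i)) ((E j).image (· * h j))) ∧
      (Finset.univ.biUnion fun i => (E i).image (· * h i)).card = T'.card ∧
      ∀ i, ∃ c ∈ C, c ∈ (E i).image (· * h i) := by
  have hsum : T'.card = ∑ i, (E i).card := by
    rw [hpart, Finset.card_biUnion fun i _ j _ hij => hdisj i j hij]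
  obtain ⟨h, hdis, hmem⟩ := exists_pairwiseDisjoint_image_mul_right C E hne Finset.univ
    (by rw [← hsum, hC]; nlinarith)
  have hpair : ∀ i j, i ≠ j → Disjoint ((E i).image (· * h i)) ((E j).image (· * h j)) :=
    fun i j hij => hdis (Finset.mem_coe.2 (Finset.mem_univ i))
      (Finset.mem_coe.2 (Finset.mem_univ j)) hij
  refine ⟨h, hpair, ?_, fun i => hmem i (Finset.mem_univ i)⟩
  rw [Finset.card_biUnion fun i _ j _ hij => hpair i j hij, hsum]
  exact Finset.sum_congr rfl fun i _ => Finset.card_image_of_injective _ (mul_left_injective (h i))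
end
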